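/- Let a < b be integers and f : [a,b] → ℝ twice differentiable with −f''(x) ≥ ρ > 0 for all x ∈ [a,b]. Then |∑_{k=a}^{b} e^{2iπ f(k)}| ≤ (|f'(b) − f'(a)| + 2)(4/√ρ + 3). -/

import Mathlib

/-- For `x` within `[δ, 1 - δ]` the sine of `π x` is at least `2 δ`. -/
lemma two_mul_le_sin_pi_mul {δ x : ℝ} (hδ : 0 < δ) (h1 : δ ≤ x) (h2 : x ≤ 1 - δ) :
    2 * δ ≤ Real.sin (Real.pi * x) := by
  have hpi := Real.pi_pos
  have key : ∀ y : ℝ, δ ≤ y → y ≤ 1 / 2 → 2 * δ ≤ Real.sin (Real.pi * y) := by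
    intro y h1 h2
    have h := Real.mul_le_sin (x := Real.pi * y) (by nlinarith) (by nlinarith)
    have e : 2 / Real.pi * (Real.pi * y) = 2 * y := by field_simp
    linarith
  rcases le_total x (1 / 2) with h | h
  · exact key x h1 h
  · rw [← Real.sin_pi_sub, show Real.pi - Real.pi * x = Real.pi * (1 - x) by ring]
    exact key _ (by linarith) (by linarith)

lemma cot_le_cot_of_le {x y : ℝ} (hx : 0 < x) (hxy : x ≤ y) (hy : y < Real.pi) :
    Real.cot y ≤ Real.cot x := by
  have sx := Real.sin_pos_of_pos_of_lt_pi hx (hxy.trans_lt hy)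
  have sy := Real.sin_pos_of_pos_of_lt_pi (hx.trans_le hxy) hy
  have h : 0 ≤ Real.sin (y - x) :=
    Real.sin_nonneg_of_nonneg_of_le_pi (by linarith) (by linarith)
  rw [Real.sin_sub] at h
  rw [Real.cot_eq_cos_div_sin, Real.cot_eq_cos_div_sin, div_le_div_iff₀ sy sx]
  linarith

lemma abs_cot_le_one_div_sin {x : ℝ} (hx : 0 < Real.sin x) :
    |Real.cot x| ≤ 1 / Real.sin x := by
  rw [Real.cot_eq_cos_div_sin, abs_div, abs_of_pos hx]
  gcongr
  exact Real.abs_cos_le_one x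

lemma sqrt_one_add_cot_sq {x : ℝ} (hx : 0 < Real.sin x) :
    √(1 + Real.cot x ^ 2) = 1 / Real.sin x := by
  rw [Real.sqrt_eq_iff_mul_self_eq (by positivity) (by positivity), Real.cot_eq_cos_div_sin]
  field_simp
  linarith [Real.sin_sq_add_cos_sq x]

/-- The value `1 / (1 - exp (2 i x))`, written through the cotangent. -/
noncomputable def cotKernel (x : ℝ) : ℂ := (1 + Real.cot x * Complex.I) / 2

lemma one_sub_exp_mul_cotKernel {x : ℝ} (hx : Real.sin x ≠ 0) :
    (1 - Complex.exp (2 * x * Complex.I)) * cotKernel x = 1 := by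
  have hs : (Real.sin x : ℂ) ≠ 0 := by exact_mod_cast hx
  have e : Complex.exp (2 * x * Complex.I)
      = ((Real.cos x : ℂ) + Real.sin x * Complex.I) ^ 2 := by
    rw [show (2 * x * Complex.I : ℂ) = (x * Complex.I) + (x * Complex.I) by ring,
      Complex.exp_add, Complex.exp_mul_I]
    push_cast
    ring
  have h1 : (Real.sin x : ℂ) ^ 2 + (Real.cos x : ℂ) ^ 2 = 1 := by
    exact_mod_cast Real.sin_sq_add_cos_sq x
  rw [e, cotKernel, Real.cot_eq_cos_div_sin]
  simp only [Complex.ofReal_div]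
  generalize (Real.sin x : ℂ) = s at *
  generalize (Real.cos x : ℂ) = c at *
  have hI := Complex.I_sq
  field_simp
  have hc : c ^ 2 = 1 - s ^ 2 := by linear_combination h1
  grind

lemma norm_cotKernel {x : ℝ} (hx : 0 < Real.sin x) :
    ‖cotKernel x‖ = 1 / (2 * Real.sin x) := by
  have h := Complex.norm_add_mul_I 1 (Real.cot x)
  rw [one_pow, sqrt_one_add_cot_sq hx] at h
  rw [cotKernel, norm_div, ← Complex.ofReal_one, h, Complex.norm_two]
  field_simp

lemma norm_one_sub_cotKernel {x : ℝ} (hx : 0 < Real.sin x) :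
    ‖1 - cotKernel x‖ = 1 / (2 * Real.sin x) := by
  have h := Complex.norm_add_mul_I 1 (-Real.cot x)
  rw [one_pow, neg_sq, sqrt_one_add_cot_sq hx] at h
  rw [cotKernel, show (1 - (1 + Real.cot x * Complex.I) / 2 : ℂ)
    = ((1 : ℝ) + ((-Real.cot x : ℝ) : ℂ) * Complex.I) / 2 by push_cast; ring,
    norm_div, h, Complex.norm_two]
  field_simp

lemma norm_cotKernel_sub_of_le {x y : ℝ} (hx : 0 < x) (hxy : x ≤ y) (hy : y < Real.pi) :
    ‖cotKernel x - cotKernel y‖ = (Real.cot x - Real.cot y) / 2 := by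
  rw [cotKernel, cotKernel, show ((1 + Real.cot x * Complex.I) / 2
    - (1 + Real.cot y * Complex.I) / 2 : ℂ)
    = (((Real.cot x - Real.cot y) / 2 : ℝ) : ℂ) * Complex.I by push_cast; ring,
    norm_mul, Complex.norm_I, mul_one, Complex.norm_real, Real.norm_of_nonneg]
  linarith [cot_le_cot_of_le hx hxy hy]

lemma norm_exp_two_pi_I_mul (t : ℝ) :
    ‖Complex.exp (2 * Real.pi * Complex.I * (t : ℂ))‖ = 1 := by
  rw [show (2 * Real.pi * Complex.I * (t : ℂ)) = ((2 * Real.pi * t : ℝ) : ℂ) * Complex.I by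
    push_cast; ring, Complex.norm_exp_ofReal_mul_I]

/-- The **Kusmin–Landau inequality** for phases with decreasing increments. -/
theorem norm_sum_exp_le_of_antitone_increments (u : ℕ → ℝ) (N : ℕ) (n : ℤ) {δ : ℝ}
    (hδ : 0 < δ) (hδ2 : δ ≤ 1 / 2)
    (hlow : ∀ k < N, n + δ ≤ u (k + 1) - u k)
    (hupp : ∀ k < N, u (k + 1) - u k ≤ n + 1 - δ)
    (hanti : ∀ k, k + 1 < N → u (k + 2) - u (k + 1) ≤ u (k + 1) - u k) :
    ‖∑ k ∈ Finset.range (N + 1), Complex.exp (2 * Real.pi * Complex.I * (u k : ℂ))‖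
      ≤ 1 / δ := by
  have hpi := Real.pi_pos
  set z : ℕ → ℂ := fun k => Complex.exp (2 * Real.pi * Complex.I * (u k : ℂ)) with hz
  have hz1 : ∀ k, ‖z k‖ = 1 := fun k => norm_exp_two_pi_I_mul (u k)
  set x : ℕ → ℝ := fun k => Real.pi * (u (k + 1) - u k - n) with hx
  have hsin : ∀ k < N, 2 * δ ≤ Real.sin (x k) := fun k hk =>
    two_mul_le_sin_pi_mul hδ (by linarith [hlow k hk]) (by linarith [hupp k hk])
  have hsin0 : ∀ k < N, 0 < Real.sin (x k) := fun k hk => by linarith [hsin k hk]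
  have hinv : ∀ k < N, 1 / Real.sin (x k) ≤ 1 / (2 * δ) := fun k hk =>
    one_div_le_one_div_of_le (by linarith) (hsin k hk)
  have hx0 : ∀ k < N, 0 < x k := fun k hk =>
    mul_pos hpi (by linarith [hlow k hk])
  have hxpi : ∀ k < N, x k < Real.pi := fun k hk => by
    have := hupp k hk
    simp only [hx]
    nlinarith
  have hstep : ∀ k < N, z k * (1 - cotKernel (x k)) = - (z (k + 1) * cotKernel (x k)) := by
    intro k hk
    have h := one_sub_exp_mul_cotKernel (hsin0 k hk).ne'
    have hmul : z (k + 1) = z k * Complex.exp (2 * x k * Complex.I) := by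
      rw [hz, ← Complex.exp_add]
      refine Complex.exp_eq_exp_iff_exists_int.2 ⟨n, ?_⟩
      simp only [hx]
      push_cast
      ring
    rw [hmul]
    linear_combination (-z k) * h
  have hpartial : ∀ m < N, ‖∑ k ∈ Finset.range m, z k + z m * cotKernel (x m)‖
      ≤ 1 / (2 * Real.sin (x 0)) + (Real.cot (x m) - Real.cot (x 0)) / 2 := by
    intro m
    induction m with
    | zero =>
      intro h
      simp [hz1, norm_cotKernel (hsin0 0 h)]
    | succ m ih =>
      intro h
      have hm : m < N := by omega
      have hle : x (m + 1) ≤ x m := by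
        simp only [hx]
        have := hanti m h
        gcongr
      have e : ∑ k ∈ Finset.range (m + 1), z k + z (m + 1) * cotKernel (x (m + 1))
          = (∑ k ∈ Finset.range m, z k + z m * cotKernel (x m))
            + z (m + 1) * (cotKernel (x (m + 1)) - cotKernel (x m)) := by
        rw [Finset.sum_range_succ]
        linear_combination hstep m hm
      rw [e]
      refine (norm_add_le _ _).trans ?_
      rw [norm_mul, hz1, one_mul, norm_cotKernel_sub_of_le (hx0 _ h) hle (hxpi _ hm)]
      linarith [ih hm]
  rcases N with _ | N
  · simp only [zero_add, Finset.sum_range_one]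
    refine (hz1 0).le.trans ?_
    rw [le_div_iff₀ hδ]
    linarith
  · have hN : N < N + 1 := by omega
    have h0 : 0 < N + 1 := by omega
    have e : ∑ k ∈ Finset.range (N + 1 + 1), z k
        = (∑ k ∈ Finset.range N, z k + z N * cotKernel (x N))
          + z (N + 1) * (1 - cotKernel (x N)) := by
      rw [Finset.sum_range_succ, Finset.sum_range_succ]
      linear_combination hstep N hN
    rw [e]
    refine (norm_add_le _ _).trans ?_
    rw [norm_mul, hz1, one_mul, norm_one_sub_cotKernel (hsin0 N hN)]
    have hp := hpartial N hN
    have c0 := (abs_le.1 (abs_cot_le_one_div_sin (hsin0 0 h0))).1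
    have cN := (abs_le.1 (abs_cot_le_one_div_sin (hsin0 N hN))).2
    have i0 := hinv 0 h0
    have iN := hinv N hN
    have half : ∀ s : ℝ, 1 / (2 * s) = 1 / s / 2 := fun s => by rw [div_div, mul_comm]
    rw [half] at hp i0 iN ⊢
    linarith

/-- A finite set of integers of diameter at most `L` has at most `L + 1` elements. -/
lemma card_le_of_sub_le {s : Finset ℤ} {L : ℝ} (hL : 0 ≤ L)
    (h : ∀ x ∈ s, ∀ y ∈ s, (y : ℝ) - x ≤ L) : (s.card : ℝ) ≤ L + 1 := by
  rcases s.eq_empty_or_nonempty with rfl | hs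
  · simp only [Finset.card_empty, Nat.cast_zero]
    linarith
  · have hsub : s ⊆ Finset.Icc (s.min' hs) (s.max' hs) := fun x hx =>
      Finset.mem_Icc.2 ⟨s.min'_le x hx, s.le_max' x hx⟩
    have hc := Finset.card_le_card hsub
    have hmm := s.min'_le _ (s.max'_mem hs)
    rw [Int.card_Icc] at hc
    have hc' : (s.card : ℤ) ≤ s.max' hs + 1 - s.min' hs := by omega
    have hc'' : (s.card : ℝ) ≤ s.max' hs + 1 - s.min' hs := by exact_mod_cast hc'
    linarith [h _ (s.min'_mem hs) _ (s.max'_mem hs)]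

/-- The Kusmin–Landau inequality for a differentiable phase whose derivative is decreasing
and stays away from the integers. -/
theorem norm_sum_exp_le_of_antitoneOn_deriv {c d : ℤ} (hcd : c ≤ d) {f f' : ℝ → ℝ} (n : ℤ)
    {δ : ℝ} (hδ : 0 < δ) (hδ2 : δ ≤ 1 / 2)
    (hder : ∀ x ∈ Set.Icc (c : ℝ) d, HasDerivAt f (f' x) x)
    (hanti : AntitoneOn f' (Set.Icc (c : ℝ) d))
    (hc : f' c ≤ n + 1 - δ) (hd : n + δ ≤ f' d) :
    ‖∑ k ∈ Finset.Icc c d, Complex.exp (2 * Real.pi * Complex.I * (f k : ℂ))‖ ≤ 1 / δ := by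
  obtain ⟨N, rfl⟩ := Int.le.dest hcd
  have hmem : ∀ t : ℝ, 0 ≤ t → t ≤ N → (c + t : ℝ) ∈ Set.Icc (c : ℝ) ((c + N : ℤ) : ℝ) := by
    intro t h0 h1
    push_cast
    exact ⟨by linarith, by linarith⟩
  have hmvt : ∀ k < N, ∃ t : ℝ, k < t ∧ t < k + 1 ∧
      f' (c + t) = f (c + (k + 1 : ℕ)) - f (c + k) := by
    intro k hk
    have hk' : (k : ℝ) + 1 ≤ N := by exact_mod_cast hk
    have hk0 : (0 : ℝ) ≤ k := k.cast_nonneg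
    have hsub : ∀ x ∈ Set.Icc (c + k : ℝ) (c + (k + 1 : ℕ)), HasDerivAt f (f' x) x := by
      intro x hx
      push_cast at hx
      have := hmem (x - c) (by linarith [hx.1]) (by linarith [hx.2])
      exact hder x (by simpa using this)
    obtain ⟨y, hy, hy'⟩ := exists_hasDerivAt_eq_slope f f'
      (show (c + k : ℝ) < c + (k + 1 : ℕ) by push_cast; linarith)
      (fun x hx => (hsub x hx).continuousAt.continuousWithinAt)
      (fun x hx => hsub x (Set.Ioo_subset_Icc_self hx))
    push_cast at hy
    refine ⟨y - c, by linarith [hy.1], by linarith [hy.2], ?_⟩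
    rw [add_sub_cancel, hy']
    push_cast
    rw [show (c + (k + 1) - (c + k) : ℝ) = 1 by ring, div_one]
  choose! t ht0 ht1 ht using hmvt
  have htmem : ∀ k < N, (c + t k : ℝ) ∈ Set.Icc (c : ℝ) ((c + N : ℤ) : ℝ) := by
    intro k hk
    have hk' : (k : ℝ) + 1 ≤ N := by exact_mod_cast hk
    have hk0 : (0 : ℝ) ≤ k := k.cast_nonneg
    exact hmem _ (by linarith [ht0 k hk]) (by linarith [ht1 k hk])
  have hcd' : (c : ℝ) ≤ ((c + N : ℤ) : ℝ) := by exact_mod_cast hcd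
  have hsum : ∑ k ∈ Finset.Icc c (c + N), Complex.exp (2 * Real.pi * Complex.I * (f k : ℂ))
      = ∑ k ∈ Finset.range (N + 1),
        Complex.exp (2 * Real.pi * Complex.I * (f (c + k) : ℂ)) := by
    symm
    refine Finset.sum_bij (fun k _ => c + (k : ℤ)) ?_ ?_ ?_ ?_
    · intro k hk
      rw [Finset.mem_range] at hk
      rw [Finset.mem_Icc]
      omega
    · intro i _ j _ h
      omega
    · intro j hj
      rw [Finset.mem_Icc] at hj
      refine ⟨(j - c).toNat, ?_, ?_⟩
      · rw [Finset.mem_range]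
        omega
      · omega
    · intro k _
      push_cast
      rfl
  rw [hsum]
  refine norm_sum_exp_le_of_antitone_increments (fun k : ℕ => f (c + k)) N n hδ hδ2 ?_ ?_ ?_
  · intro k hk
    rw [← ht k hk]
    exact hd.trans (hanti (htmem k hk) (Set.right_mem_Icc.2 hcd') (htmem k hk).2)
  · intro k hk
    rw [← ht k hk]
    exact (hanti (Set.left_mem_Icc.2 hcd') (htmem k hk) (htmem k hk).1).trans hc
  · intro k hk
    have hk' : k < N := by omega
    have h1 := ht (k + 1) hk
    rw [← ht k hk', ← h1]
    refine hanti (htmem k hk') (htmem (k + 1) hk) ?_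
    have h2 := ht0 (k + 1) hk
    push_cast at h2
    linarith [ht1 k hk']

/-- The part of the sum on which the derivative lies within one unit cell. -/
lemma norm_sum_exp_filter_floor_le {a b : ℤ} {f f' : ℝ → ℝ} {ρ δ : ℝ} (hρ : 0 < ρ)
    (hδ : 0 < δ) (hδ2 : δ ≤ 1 / 2)
    (hder : ∀ x ∈ Set.Icc (a : ℝ) b, HasDerivAt f (f' x) x)
    (hslope : ∀ x ∈ Set.Icc (a : ℝ) b, ∀ y ∈ Set.Icc (a : ℝ) b, x ≤ y →
      ρ * (y - x) ≤ f' x - f' y) (n : ℤ) :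
    ‖∑ k ∈ (Finset.Icc a b).filter (fun k : ℤ => ⌊f' k + δ⌋ = n),
      Complex.exp (2 * Real.pi * Complex.I * (f k : ℂ))‖ ≤ 2 * δ / ρ + 1 + 1 / δ := by
  have hanti : AntitoneOn f' (Set.Icc (a : ℝ) b) := fun x hx y hy hxy => by
    nlinarith [hslope x hx y hy hxy]
  have hcast : ∀ k : ℤ, k ∈ Finset.Icc a b → (k : ℝ) ∈ Set.Icc (a : ℝ) b := fun k hk => by
    rw [Finset.mem_Icc] at hk
    exact ⟨by exact_mod_cast hk.1, by exact_mod_cast hk.2⟩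
  set s := (Finset.Icc a b).filter (fun k : ℤ => ⌊f' k + δ⌋ = n) with hs
  have hsmem : ∀ k : ℤ, k ∈ s ↔ k ∈ Finset.Icc a b ∧ n ≤ f' k + δ ∧ f' k + δ < n + 1 := by
    intro k
    rw [hs, Finset.mem_filter, Int.floor_eq_iff]
  rw [← Finset.sum_filter_add_sum_filter_not s (fun k : ℤ => f' k < n + δ)]
  refine (norm_add_le _ _).trans (add_le_add ?_ ?_)
  · refine (norm_sum_le _ _).trans ?_
    simp only [norm_exp_two_pi_I_mul, Finset.sum_const, nsmul_eq_mul, mul_one]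
    refine card_le_of_sub_le (by positivity) ?_
    intro x hx y hy
    rw [Finset.mem_filter, hsmem] at hx hy
    rw [le_div_iff₀ hρ]
    rcases le_total (x : ℝ) y with h | h
    · linarith [hslope x (hcast x hx.1.1) y (hcast y hy.1.1) h]
    · nlinarith
  · set G := s.filter (fun k : ℤ => ¬ f' k < n + δ) with hG
    have hGmem : ∀ k : ℤ, k ∈ G ↔
        k ∈ Finset.Icc a b ∧ n + δ ≤ f' k ∧ f' k < n + 1 - δ := by
      intro k
      rw [hG, Finset.mem_filter, hsmem, not_lt]
      constructor
      · rintro ⟨⟨h1, h2, h3⟩, h4⟩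
        exact ⟨h1, h4, by linarith⟩
      · rintro ⟨h1, h2, h3⟩
        exact ⟨⟨h1, by linarith, by linarith⟩, h2⟩
    rcases G.eq_empty_or_nonempty with h | h
    · rw [h, Finset.sum_empty, norm_zero]
      positivity
    · have hc := (hGmem _).1 (G.min'_mem h)
      have hd := (hGmem _).1 (G.max'_mem h)
      have hcd := G.min'_le _ (G.max'_mem h)
      have hca := hcast _ hc.1
      have hda := hcast _ hd.1
      have hsub : Set.Icc ((G.min' h : ℤ) : ℝ) (G.max' h : ℤ) ⊆ Set.Icc (a : ℝ) b :=
        Set.Icc_subset_Icc hca.1 hda.2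
      have hGeq : G = Finset.Icc (G.min' h) (G.max' h) := by
        ext k
        refine ⟨fun hk => Finset.mem_Icc.2 ⟨G.min'_le k hk, G.le_max' k hk⟩, fun hk => ?_⟩
        rw [Finset.mem_Icc] at hk
        have h1 : ((G.min' h : ℤ) : ℝ) ≤ k := by exact_mod_cast hk.1
        have h2 : (k : ℝ) ≤ (G.max' h : ℤ) := by exact_mod_cast hk.2
        have hk' := hsub ⟨h1, h2⟩
        exact (hGmem k).2 ⟨Finset.mem_Icc.2 ⟨by exact_mod_cast hk'.1, by exact_mod_cast hk'.2⟩,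
          hd.2.1.trans (hanti hk' hda h2), (hanti hca hk' h1).trans_lt hc.2.2⟩
      rw [hGeq]
      exact norm_sum_exp_le_of_antitoneOn_deriv hcd n hδ hδ2
        (fun x hx => hder x (hsub hx)) (hanti.mono hsub) hc.2.2.le hd.2.1

/-- Van der Corput's second-derivative exponential sum estimate. -/
theorem stmt_12 (a b : ℤ) (hab : a < b) (f f' f'' : ℝ → ℝ) (ρ : ℝ) (hρ : 0 < ρ)
    (hder : ∀ x ∈ Set.Icc (a : ℝ) (b : ℝ), HasDerivAt f (f' x) x)
    (hder2 : ∀ x ∈ Set.Icc (a : ℝ) (b : ℝ), HasDerivAt f' (f'' x) x)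
    (hconc : ∀ x ∈ Set.Icc (a : ℝ) (b : ℝ), ρ ≤ -f'' x) :
    ‖∑ k ∈ Finset.Icc a b, Complex.exp (2 * Real.pi * Complex.I * (f k : ℂ))‖
      ≤ (|f' b - f' a| + 2) * (4 / Real.sqrt ρ + 3) := by
  have hslope : ∀ x ∈ Set.Icc (a : ℝ) b, ∀ y ∈ Set.Icc (a : ℝ) b, x ≤ y →
      ρ * (y - x) ≤ f' x - f' y := by
    intro x hx y hy hxy
    rcases hxy.eq_or_lt with rfl | hlt
    · simp
    have hsub : Set.Icc x y ⊆ Set.Icc (a : ℝ) b := Set.Icc_subset_Icc hx.1 hy.2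
    obtain ⟨t, ht, ht'⟩ := exists_hasDerivAt_eq_slope f' f'' hlt
      (fun z hz => (hder2 z (hsub hz)).continuousAt.continuousWithinAt)
      (fun z hz => hder2 z (hsub (Set.Ioo_subset_Icc_self hz)))
    have h := hconc t (hsub (Set.Ioo_subset_Icc_self ht))
    rw [ht', ← neg_div, le_div_iff₀ (sub_pos.2 hlt)] at h
    linarith
  have hab' : (a : ℝ) < b := by exact_mod_cast hab
  have ha := Set.left_mem_Icc.2 hab'.le
  have hb := Set.right_mem_Icc.2 hab'.le
  have hlen := hslope a ha b hb hab'.le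
  have hD : 0 ≤ f' a - f' b := le_trans (by nlinarith) hlen
  rw [abs_sub_comm, abs_of_nonneg hD]
  have hr : 0 < √ρ := Real.sqrt_pos.2 hρ
  have hsq : √ρ * √ρ = ρ := Real.mul_self_sqrt hρ.le
  rcases le_total (√ρ) (1 / 2) with hsmall | hlarge
  · have hanti : AntitoneOn f' (Set.Icc (a : ℝ) b) := fun x hx y hy hxy => by
      nlinarith [hslope x hx y hy hxy]
    have hmaps : ∀ k ∈ Finset.Icc a b,
        ⌊f' k + √ρ⌋ ∈ Finset.Icc ⌊f' b + √ρ⌋ ⌊f' a + √ρ⌋ := by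
      intro k hk
      rw [Finset.mem_Icc] at hk
      have hk' : (k : ℝ) ∈ Set.Icc (a : ℝ) b :=
        ⟨by exact_mod_cast hk.1, by exact_mod_cast hk.2⟩
      rw [Finset.mem_Icc]
      constructor <;> apply Int.floor_le_floor <;> gcongr
      · exact hanti hk' hb hk'.2
      · exact hanti ha hk' hk'.1
    have hcard : ((Finset.Icc ⌊f' b + √ρ⌋ ⌊f' a + √ρ⌋).card : ℝ) ≤ f' a - f' b + 2 := by
      have hle : ⌊f' b + √ρ⌋ ≤ ⌊f' a + √ρ⌋ := Int.floor_le_floor (by linarith)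
      have h1 : ((Finset.Icc ⌊f' b + √ρ⌋ ⌊f' a + √ρ⌋).card : ℤ)
          = ⌊f' a + √ρ⌋ + 1 - ⌊f' b + √ρ⌋ := by
        rw [Int.card_Icc]
        omega
      have h2 : ((Finset.Icc ⌊f' b + √ρ⌋ ⌊f' a + √ρ⌋).card : ℝ)
          = ⌊f' a + √ρ⌋ + 1 - ⌊f' b + √ρ⌋ := by exact_mod_cast h1
      linarith [Int.floor_le (f' a + √ρ), Int.lt_floor_add_one (f' b + √ρ)]
    have hcell : 2 * √ρ / ρ + 1 + 1 / √ρ ≤ 4 / √ρ + 3 := by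
      have e1 : 2 * √ρ / ρ = 2 * (1 / √ρ) := by
        rw [← hsq, Real.sqrt_mul_self hr.le]
        field_simp
      have e2 : 4 / √ρ = 4 * (1 / √ρ) := by ring
      have : 0 < 1 / √ρ := by positivity
      rw [e1, e2]
      linarith
    rw [← Finset.sum_fiberwise_of_maps_to hmaps]
    refine (norm_sum_le _ _).trans ((Finset.sum_le_card_nsmul _ _ _ fun n _ =>
      norm_sum_exp_filter_floor_le hρ hr hsmall hder hslope n).trans ?_)
    rw [nsmul_eq_mul]
    exact mul_le_mul hcard hcell (by positivity) (by linarith)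
  · refine (norm_sum_le _ _).trans ?_
    simp only [norm_exp_two_pi_I_mul, Finset.sum_const, nsmul_eq_mul, mul_one]
    have hcard : ((Finset.Icc a b).card : ℝ) ≤ (b - a) + 1 :=
      card_le_of_sub_le (by linarith) fun x hx y hy => by
        rw [Finset.mem_Icc] at hx hy
        have h1 : (a : ℝ) ≤ x := by exact_mod_cast hx.1
        have h2 : (y : ℝ) ≤ b := by exact_mod_cast hy.2
        linarith
    have h4 : (b : ℝ) - a ≤ (f' a - f' b) * (4 / √ρ) := by
      rw [← mul_div_assoc, le_div_iff₀ hr]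
      have : √ρ ≤ 4 * ρ := by nlinarith
      nlinarith
    have h5 : 0 < 4 / √ρ := by positivity
    nlinarith
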